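/- arXiv:1309.1420 — 4 statements merged into one kernel-verified Lean document; each statement's English description precedes it below -/
import Mathlib

section
/- In the one-period setting, suppose there exist P₁, P₂ ∈ 𝒫 with P₁(S̄₁ − S̲₀ > 0) > 0 and P₂(S̲₁ − S̄₀ < 0) > 0. Then for every P ∈ 𝒫 there exist Q₁, Q₂ ∈ Θ_P with Q₁ ∼ Q₂ (mutually equivalent) such that E^{Q₁}[S̄₁ − S̲₀] > 0 and E^{Q₂}[S̲₁ − S̄₀] < 0. -/
open MeasureTheory Set
open scoped ENNReal

noncomputable section

/-- Convexity for a set of measures. -/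
def ConvexMeasureSet {Ω : Type*} [MeasurableSpace Ω] (𝒬 : Set (Measure Ω)) : Prop :=
  ∀ P ∈ 𝒬, ∀ Q ∈ 𝒬, ∀ a b : ℝ≥0∞, a + b = 1 → a • P + b • Q ∈ 𝒬

/-- `Θ_P`: the probability measures `R` with `P ≪ R ⋘ 𝒬` under which `f` is integrable. -/
def Theta {Ω : Type*} [MeasurableSpace Ω] (𝒬 : Set (Measure Ω)) (f : Ω → ℝ)
    (P : Measure Ω) : Set (Measure Ω) :=
  {R | IsProbabilityMeasure R ∧ P ≪ R ∧ (∃ P' ∈ 𝒬, R ≪ P') ∧ Integrable f R}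

/-- The support of the distribution of `f` under the family `𝒬`: the smallest closed set of
full measure under every member of `𝒬`. -/
def rvSupport {Ω : Type*} [MeasurableSpace Ω] (𝒬 : Set (Measure Ω)) (f : Ω → ℝ) : Set ℝ :=
  ⋂₀ {F : Set ℝ | IsClosed F ∧ ∀ P ∈ 𝒬, P (f ⁻¹' F) = 1}

/-- Every finite measure is equivalent to a finite measure under which a given nonnegative
measurable function is integrable. -/
theorem exists_equivalent_finite_measure_integrable {Ω : Type*} [MeasurableSpace Ω]
    (ν : Measure Ω) [IsFiniteMeasure ν] {g : Ω → ℝ} (hg : Measurable g) (hg0 : ∀ ω, 0 ≤ g ω) :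
    ∃ ρ : Measure Ω, IsFiniteMeasure ρ ∧ ν ≪ ρ ∧ ρ ≪ ν ∧ Integrable g ρ := by
  set w : Ω → NNReal := fun ω => Real.toNNReal (1 + g ω)⁻¹ with hw
  have hwm : Measurable w := (hg.const_add 1).inv.real_toNNReal
  have hwpos (ω : Ω) : 0 < (1 + g ω)⁻¹ := inv_pos.2 (by linarith [hg0 ω])
  have hwc (ω : Ω) : (w ω : ℝ) = (1 + g ω)⁻¹ := Real.coe_toNNReal _ (hwpos ω).le
  have hwint : Integrable (fun ω => (w ω : ℝ)) ν := by
    refine Integrable.of_bound (C := 1) hwm.coe_nnreal_real.aestronglyMeasurable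
      (Filter.Eventually.of_forall fun ω => ?_)
    rw [hwc, Real.norm_of_nonneg (hwpos ω).le]
    exact inv_le_one_of_one_le₀ (by linarith [hg0 ω])
  refine ⟨ν.withDensity fun ω => (w ω : ℝ≥0∞), ?_, ?_, withDensity_absolutelyContinuous _ _, ?_⟩
  · refine isFiniteMeasure_withDensity ?_
    have h := hwint.lintegral_lt_top
    simp only [ENNReal.ofReal_coe_nnreal] at h
    exact h.ne
  · refine withDensity_absolutelyContinuous' hwm.coe_nnreal_ennreal.aemeasurable
      (Filter.Eventually.of_forall fun ω => ?_)
    exact_mod_cast (Real.toNNReal_pos.2 (hwpos ω)).ne'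
  · rw [integrable_withDensity_iff_integrable_smul hwm]
    refine Integrable.of_bound (C := 1) (hwm.smul hg).aestronglyMeasurable
      (Filter.Eventually.of_forall fun ω => ?_)
    have h1 : w ω • g ω = (1 + g ω)⁻¹ * g ω := by rw [NNReal.smul_def, hwc, smul_eq_mul]
    rw [h1, Real.norm_of_nonneg (mul_nonneg (hwpos ω).le (hg0 ω)), inv_mul_eq_div]
    exact div_le_one_of_le₀ (by linarith) (by linarith [hg0 ω])

/-- If `ν` charges `{f > 0}` and `|f| ≤ g`, some probability measure equivalent to `ν` integrates
`g` and gives `f` positive expectation. -/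
theorem exists_equivalent_probability_integral_pos {Ω : Type*} [MeasurableSpace Ω]
    (ν : Measure Ω) [IsFiniteMeasure ν] {f g : Ω → ℝ} (hf : Measurable f) (hg : Measurable g)
    (hfg : ∀ ω, |f ω| ≤ g ω) (hpos : 0 < ν {ω | 0 < f ω}) :
    ∃ Q : Measure Ω, IsProbabilityMeasure Q ∧ ν ≪ Q ∧ Q ≪ ν ∧ Integrable g Q ∧
      0 < ∫ ω, f ω ∂Q := by
  obtain ⟨ρ, hρ, hνρ, hρν, hgρ⟩ := exists_equivalent_finite_measure_integrable ν hg
    fun ω => (abs_nonneg _).trans (hfg ω)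
  have hfρ : Integrable f ρ :=
    hgρ.mono' hf.aestronglyMeasurable (Filter.Eventually.of_forall hfg)
  set A : Set Ω := {ω | 0 < f ω} with hA
  have hAm : MeasurableSet A := measurableSet_lt measurable_const hf
  have hρA : 0 < ρ A := pos_iff_ne_zero.2 fun h => hpos.ne' (hνρ h)
  have hJ : 0 < ∫ ω in A, f ω ∂ρ := by
    rw [setIntegral_pos_iff_support_of_nonneg_ae
      ((ae_restrict_mem hAm).mono fun ω (hω : 0 < f ω) => hω.le) hfρ.integrableOn]
    refine hρA.trans_le (measure_mono fun ω hω => ⟨ne_of_gt hω, hω⟩)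
  obtain ⟨n, hn⟩ := exists_nat_gt (-(∫ ω, f ω ∂ρ) / ∫ ω in A, f ω ∂ρ)
  rw [div_lt_iff₀ hJ] at hn
  set σ : Measure Ω := ρ + (n : NNReal) • ρ.restrict A with hσ
  have hρσ : ρ ≪ σ := Measure.absolutelyContinuous_of_le (Measure.le_add_right le_rfl)
  have hσρ : σ ≪ ρ := by
    refine Measure.AbsolutelyContinuous.add_left Measure.AbsolutelyContinuous.rfl ?_
    exact (Measure.absolutelyContinuous_of_le Measure.restrict_le_self).smul_left _
  have hint {h : Ω → ℝ} (hh : Integrable h ρ) : Integrable h σ :=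
    hh.add_measure (hh.restrict.smul_measure_nnreal)
  have hσf : 0 < ∫ ω, f ω ∂σ := by
    rw [hσ, integral_add_measure hfρ (hfρ.restrict.smul_measure_nnreal),
      integral_smul_nnreal_measure, NNReal.smul_def, smul_eq_mul, NNReal.coe_natCast]
    linarith
  have hσ0 : σ univ ≠ 0 := fun h => hρA.ne' (hρσ (measure_mono_null (subset_univ _) h))
  have hσtop : σ univ ≠ ⊤ := measure_ne_top σ univ
  have : NeZero σ := ⟨fun h => hσ0 (by simp [h])⟩
  refine ⟨(σ univ)⁻¹ • σ, isProbabilityMeasureSMul, ?_, ?_, ?_, ?_⟩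
  · exact (hνρ.trans hρσ).trans
      (Measure.absolutelyContinuous_smul (ENNReal.inv_ne_zero.2 hσtop))
  · exact (hσρ.trans hρν).smul_left _
  · exact (hint hgρ).smul_measure (ENNReal.inv_ne_top.2 hσ0)
  · rw [integral_smul_measure, smul_eq_mul]
    exact mul_pos (ENNReal.toReal_pos (ENNReal.inv_ne_zero.2 hσtop) (ENNReal.inv_ne_top.2 hσ0)) hσf

/-- In a convex set of measures, any two members are dominated by a third. -/
theorem ConvexMeasureSet.exists_absolutelyContinuous {Ω : Type*} [MeasurableSpace Ω]
    {𝒬 : Set (Measure Ω)} (h𝒬 : ConvexMeasureSet 𝒬) {P Q : Measure Ω} (hP : P ∈ 𝒬) (hQ : Q ∈ 𝒬) :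
    ∃ R ∈ 𝒬, P ≪ R ∧ Q ≪ R := by
  have h2 : (2⁻¹ : ℝ≥0∞) ≠ 0 := by simp
  refine ⟨_, h𝒬 P hP Q hQ 2⁻¹ 2⁻¹ ENNReal.inv_two_add_inv_two, ?_, ?_⟩
  · exact (Measure.absolutelyContinuous_smul h2).trans
      (Measure.absolutelyContinuous_of_le (Measure.le_add_right le_rfl))
  · exact (Measure.absolutelyContinuous_smul h2).trans
      (Measure.absolutelyContinuous_of_le (Measure.le_add_left le_rfl))

/-- Lemma 3.1. In the one-period market with bid/ask prices
`S̲₀ = Sb0, S̄₀ = Sa0, S̲₁ = Sb1, S̄₁ = Sa1`, if some `P₁ ∈ 𝒬` charges `{S̄₁ - S̲₀ > 0}` and some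
`P₂ ∈ 𝒬` charges `{S̲₁ - S̄₀ < 0}`, then for every `P ∈ 𝒬` there are equivalent
`Q₁, Q₂ ∈ Θ_P` with `E^{Q₁}[S̄₁ - S̲₀] > 0` and `E^{Q₂}[S̲₁ - S̄₀] < 0`. -/
theorem one_period_fundamental_lemma {Ω : Type*} [MeasurableSpace Ω]
    (𝒬 : Set (Measure Ω)) (hne : 𝒬.Nonempty)
    (hprob : ∀ P ∈ 𝒬, IsProbabilityMeasure P) (hconv : ConvexMeasureSet 𝒬)
    (Sb0 Sa0 : ℝ) (Sb1 Sa1 : Ω → ℝ) (hSb1 : Measurable Sb1) (hSa1 : Measurable Sa1)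
    (hSb0 : 0 < Sb0) (hSa0 : 0 < Sa0)
    (hSb1pos : ∀ ω, 0 < Sb1 ω) (hSa1pos : ∀ ω, 0 < Sa1 ω)
    (P₁ : Measure Ω) (hP₁ : P₁ ∈ 𝒬) (h₁ : 0 < P₁ {ω | 0 < Sa1 ω - Sb0})
    (P₂ : Measure Ω) (hP₂ : P₂ ∈ 𝒬) (h₂ : 0 < P₂ {ω | Sb1 ω - Sa0 < 0}) :
    ∀ P ∈ 𝒬, ∃ Q₁ Q₂ : Measure Ω,
      Q₁ ∈ Theta 𝒬 (fun ω => |Sa1 ω - Sb0| + |Sb1 ω - Sa0|) P ∧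
      Q₂ ∈ Theta 𝒬 (fun ω => |Sa1 ω - Sb0| + |Sb1 ω - Sa0|) P ∧
      Q₁ ≪ Q₂ ∧ Q₂ ≪ Q₁ ∧
      0 < ∫ ω, (Sa1 ω - Sb0) ∂Q₁ ∧ ∫ ω, (Sb1 ω - Sa0) ∂Q₂ < 0 := by
  intro P hP
  obtain ⟨P', hP', h1P', h2P'⟩ := hconv.exists_absolutelyContinuous hP₁ hP₂
  obtain ⟨ν, hν, hPν, hP'ν⟩ := hconv.exists_absolutelyContinuous hP hP'
  have := hprob ν hν
  have hfa : Measurable fun ω => Sa1 ω - Sb0 := hSa1.sub_const _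
  have hfb : Measurable fun ω => Sb1 ω - Sa0 := hSb1.sub_const _
  have hg : Measurable fun ω => |Sa1 ω - Sb0| + |Sb1 ω - Sa0| := hfa.abs.add hfb.abs
  obtain ⟨Q₁, hQ₁, hνQ₁, hQ₁ν, hi₁, hpos₁⟩ := exists_equivalent_probability_integral_pos ν hfa hg
    (fun ω => le_add_of_nonneg_right (abs_nonneg _))
    (pos_iff_ne_zero.2 fun h => h₁.ne' (h1P'.trans hP'ν h))
  obtain ⟨Q₂, hQ₂, hνQ₂, hQ₂ν, hi₂, hpos₂⟩ :=
    exists_equivalent_probability_integral_pos ν hfb.neg hg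
      (fun ω => by
        rw [Pi.neg_apply, abs_neg]
        exact le_add_of_nonneg_left (abs_nonneg _))
      (pos_iff_ne_zero.2 fun h => h₂.ne' (h2P'.trans hP'ν (by simpa using h)))
  refine ⟨Q₁, Q₂, ⟨hQ₁, hPν.trans hνQ₁, ⟨ν, hν, hQ₁ν⟩, hi₁⟩,
    ⟨hQ₂, hPν.trans hνQ₂, ⟨ν, hν, hQ₂ν⟩, hi₂⟩, hQ₁ν.trans hνQ₂, hQ₂ν.trans hνQ₁, hpos₁, ?_⟩
  simp only [Pi.neg_apply, integral_neg] at hpos₂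
  linarith
end
end

section
/- In the one-period setting, suppose s ∈ ℝ satisfies inf supp_𝒫 S̲₁ < s < sup supp_𝒫 S̄₁. Then for every P ∈ 𝒫 there exist Q₁, Q₂ ∈ Θ_P with Q₁ ∼ Q₂ such that E^{Q₂}[S̲₁] < s < E^{Q₁}[S̄₁]. -/
open MeasureTheory Set
open scoped ENNReal

noncomputable section

/-- A finite measure can be replaced by an equivalent finite one under which a given nonnegative
measurable function is integrable. -/
theorem exists_equivalent_integrable {Ω : Type*} [MeasurableSpace Ω] (P : Measure Ω)
    [IsFiniteMeasure P] {f : Ω → ℝ} (hf : Measurable f) (hf0 : ∀ ω, 0 ≤ f ω) :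
    ∃ R : Measure Ω, IsFiniteMeasure R ∧ P ≪ R ∧ R ≪ P ∧ Integrable f R := by
  have hd : Measurable fun ω => ENNReal.ofReal (1 / (1 + f ω)) := by fun_prop
  have hpos : ∀ ω, 0 < 1 / (1 + f ω) := fun ω => by have := hf0 ω; positivity
  have hint : Integrable (fun ω => 1 / (1 + f ω)) P := by
    refine Integrable.of_bound (Measurable.aestronglyMeasurable (by fun_prop)) 1 (ae_of_all _ fun ω => ?_)
    rw [Real.norm_of_nonneg (hpos ω).le, div_le_one (by linarith [hf0 ω])]
    linarith [hf0 ω]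
  refine ⟨P.withDensity fun ω => ENNReal.ofReal (1 / (1 + f ω)),
    isFiniteMeasure_withDensity_ofReal hint.2,
    withDensity_absolutelyContinuous' hd.aemeasurable (ae_of_all _ fun ω => ?_),
    withDensity_absolutelyContinuous _ _, ?_⟩
  · simpa using hpos ω
  · rw [integrable_withDensity_iff_integrable_smul' hd (ae_of_all _ fun _ => ENNReal.ofReal_lt_top)]
    refine Integrable.of_bound (Measurable.aestronglyMeasurable (by fun_prop)) 1 (ae_of_all _ fun ω => ?_)
    rw [ENNReal.toReal_ofReal (hpos ω).le, smul_eq_mul,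
      Real.norm_of_nonneg (mul_nonneg (hpos ω).le (hf0 ω)), one_div_mul_eq_div,
      div_le_one (by linarith [hf0 ω])]
    linarith

/-- If `g < s` with positive measure, some equivalent probability measure gives `g` mean below
`s`, with densities bounded so that integrability is preserved. -/
theorem exists_equivalent_integral_lt {Ω : Type*} [MeasurableSpace Ω] (ν : Measure Ω)
    [IsFiniteMeasure ν] {f g : Ω → ℝ} (hf : Integrable f ν) (hgm : Measurable g)
    (hg : Integrable g ν) {s : ℝ} (hs : ν {ω | g ω < s} ≠ 0) :
    ∃ Q : Measure Ω, IsProbabilityMeasure Q ∧ ν ≪ Q ∧ Q ≪ ν ∧ Integrable f Q ∧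
      ∫ ω, g ω ∂Q < s := by
  set A := {ω | g ω < s}
  have hA : MeasurableSet A := measurableSet_lt hgm measurable_const
  have hgs : Integrable (fun ω => g ω - s) ν := hg.sub (integrable_const s)
  have hneg : 0 < -(∫ ω in A, (g ω - s) ∂ν) := by
    rw [← integral_neg, setIntegral_pos_iff_support_of_nonneg_ae]
    · refine (pos_iff_ne_zero.2 hs).trans_le (measure_mono fun ω hω => ⟨?_, hω⟩)
      have : g ω < s := hω
      simp only [Function.mem_support]
      linarith
    · refine (ae_restrict_iff' hA).2 (ae_of_all _ fun ω (hω : g ω < s) => ?_)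
      simp only [Pi.zero_apply]
      linarith
    · exact hgs.neg.integrableOn
  obtain ⟨n, hn⟩ := exists_nat_gt ((∫ ω, (g ω - s) ∂ν) / (-(∫ ω in A, (g ω - s) ∂ν)))
  rw [div_lt_iff₀ hneg] at hn
  set M : Measure Ω := ν + (n : ℝ≥0∞) • ν.restrict A with hM
  have hνA : IsFiniteMeasure ((n : ℝ≥0∞) • ν.restrict A) :=
    Measure.smul_finite _ (ENNReal.natCast_ne_top n)
  have hMfin : IsFiniteMeasure M := by rw [hM]; infer_instance
  have hint : ∀ {h : Ω → ℝ}, Integrable h ν → Integrable h M := fun hh =>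
    hh.add_measure (hh.integrableOn.smul_measure (ENNReal.natCast_ne_top n))
  have hνM : ν ≪ M := Measure.absolutelyContinuous_of_le (Measure.le_add_right le_rfl)
  have hMν : M ≪ ν := Measure.AbsolutelyContinuous.add_left Measure.AbsolutelyContinuous.rfl
    (Measure.AbsolutelyContinuous.smul_left Measure.restrict_le_self.absolutelyContinuous _)
  have hM0 : M univ ≠ 0 := fun h => hs (measure_mono_null (subset_univ _) (hνM h))
  have : NeZero M := ⟨fun h => hM0 (by simp [h])⟩
  have hc0 : (M univ)⁻¹ ≠ 0 := ENNReal.inv_ne_zero.2 (measure_ne_top M univ)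
  have hct : (M univ)⁻¹ ≠ ∞ := ENNReal.inv_ne_top.2 hM0
  have hlt : ∫ ω, (g ω - s) ∂M < 0 := by
    rw [hM, integral_add_measure hgs
      (hgs.integrableOn.smul_measure (ENNReal.natCast_ne_top n)), integral_smul_measure]
    simp only [ENNReal.toReal_natCast, smul_eq_mul]
    linarith
  have hQ : IsProbabilityMeasure ((M univ)⁻¹ • M) :=
    isProbabilityMeasureSMul
  refine ⟨(M univ)⁻¹ • M, hQ, hνM.trans (Measure.absolutelyContinuous_smul hc0),
    hMν.smul_left _, (hint hf).smul_measure hct, ?_⟩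
  have hQs : ∫ ω, (g ω - s) ∂((M univ)⁻¹ • M) < 0 := by
    rw [integral_smul_measure]
    exact smul_neg_of_pos_of_neg (ENNReal.toReal_pos hc0 hct) hlt
  rw [integral_sub ((hint hg).smul_measure hct) (integrable_const s)] at hQs
  simpa using hQs

/-- A closed set missing a point of the support has complement charged by some measure. -/
theorem exists_measure_compl_ne_zero_of_mem_rvSupport {Ω : Type*} [MeasurableSpace Ω]
    {𝒬 : Set (Measure Ω)} (hprob : ∀ P ∈ 𝒬, IsProbabilityMeasure P) {f : Ω → ℝ}
    (hf : Measurable f) {x : ℝ} (hx : x ∈ rvSupport 𝒬 f) {F : Set ℝ} (hF : IsClosed F)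
    (hxF : x ∉ F) : ∃ P ∈ 𝒬, P (f ⁻¹' Fᶜ) ≠ 0 := by
  by_contra! h
  refine hxF (hx F ⟨hF, fun P hP => ?_⟩)
  have := hprob P hP
  exact (prob_compl_eq_zero_iff (hf hF.measurableSet)).1 (h P hP)

/-- Two members of a convex set of measures are dominated by a third. -/
theorem ConvexMeasureSet.exists_dominating {Ω : Type*} [MeasurableSpace Ω]
    {𝒬 : Set (Measure Ω)} (hconv : ConvexMeasureSet 𝒬) {P Q : Measure Ω} (hP : P ∈ 𝒬)
    (hQ : Q ∈ 𝒬) : ∃ R ∈ 𝒬, P ≪ R ∧ Q ≪ R := by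
  have h : (2⁻¹ : ℝ≥0∞) ≠ 0 := by simp
  exact ⟨_, hconv P hP Q hQ 2⁻¹ 2⁻¹ ENNReal.inv_two_add_inv_two,
    (Measure.absolutelyContinuous_smul h).trans
      (Measure.absolutelyContinuous_of_le (Measure.le_add_right le_rfl)),
    (Measure.absolutelyContinuous_smul h).trans
      (Measure.absolutelyContinuous_of_le (Measure.le_add_left le_rfl))⟩

/-- Proposition 3.4. If `inf supp_𝒬 S̲₁ < s < sup supp_𝒬 S̄₁` (expressed
robustly: some point of `supp_𝒬 S̲₁` lies below `s` and some point of `supp_𝒬 S̄₁` lies above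
`s`), then for every `P ∈ 𝒬` there are equivalent `Q₁, Q₂ ∈ Θ_P` with
`E^{Q₂}[S̲₁] < s < E^{Q₁}[S̄₁]`. -/
theorem one_period_martingale_initial_values {Ω : Type*} [MeasurableSpace Ω]
    (𝒬 : Set (Measure Ω)) (hne : 𝒬.Nonempty)
    (hprob : ∀ P ∈ 𝒬, IsProbabilityMeasure P) (hconv : ConvexMeasureSet 𝒬)
    (Sb1 Sa1 : Ω → ℝ) (hSb1 : Measurable Sb1) (hSa1 : Measurable Sa1)
    (s : ℝ)
    (hlow : ∃ x ∈ rvSupport 𝒬 Sb1, x < s) (hhigh : ∃ y ∈ rvSupport 𝒬 Sa1, s < y) :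
    ∀ P ∈ 𝒬, ∃ Q₁ Q₂ : Measure Ω,
      Q₁ ∈ Theta 𝒬 (fun ω => |Sa1 ω| + |Sb1 ω|) P ∧
      Q₂ ∈ Theta 𝒬 (fun ω => |Sa1 ω| + |Sb1 ω|) P ∧
      Q₁ ≪ Q₂ ∧ Q₂ ≪ Q₁ ∧
      (∫ ω, Sb1 ω ∂Q₂) < s ∧ s < ∫ ω, Sa1 ω ∂Q₁ := by
  intro P hP
  obtain ⟨x, hx, hxs⟩ := hlow
  obtain ⟨y, hy, hsy⟩ := hhigh
  obtain ⟨P₁, hP₁, h₁⟩ := exists_measure_compl_ne_zero_of_mem_rvSupport hprob hSb1 hx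
    (isClosed_Ici (a := s)) (by simpa using hxs)
  obtain ⟨P₂, hP₂, h₂⟩ := exists_measure_compl_ne_zero_of_mem_rvSupport hprob hSa1 hy
    (isClosed_Iic (a := s)) (by simpa using hsy)
  obtain ⟨P₃, hP₃, h₁₃, h₂₃⟩ := hconv.exists_dominating hP₁ hP₂
  obtain ⟨P', hP', hPP', h₃⟩ := hconv.exists_dominating hP hP₃
  have := hprob P' hP'
  have hfm : Measurable fun ω => |Sa1 ω| + |Sb1 ω| :=
    (measurable_norm.comp hSa1).add (measurable_norm.comp hSb1)
  obtain ⟨R, hR, hP'R, hRP', hint⟩ := exists_equivalent_integrable P' hfm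
    (fun ω => by positivity)
  have hb : Integrable Sb1 R := hint.mono' hSb1.aestronglyMeasurable
    (ae_of_all _ fun ω => by rw [Real.norm_eq_abs]; linarith [abs_nonneg (Sa1 ω)])
  have ha : Integrable Sa1 R := hint.mono' hSa1.aestronglyMeasurable
    (ae_of_all _ fun ω => by rw [Real.norm_eq_abs]; linarith [abs_nonneg (Sb1 ω)])
  have hRb : R {ω | Sb1 ω < s} ≠ 0 := fun h => h₁ (((h₁₃.trans h₃).trans hP'R)
    (by simpa [preimage] using h))
  have hRa : R {ω | -Sa1 ω < -s} ≠ 0 := fun h => h₂ (((h₂₃.trans h₃).trans hP'R)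
    (by simpa [preimage] using h))
  obtain ⟨Q₂, hQ₂, hRQ₂, hQ₂R, hi₂, hlt₂⟩ := exists_equivalent_integral_lt R hint hSb1 hb hRb
  obtain ⟨Q₁, hQ₁, hRQ₁, hQ₁R, hi₁, hlt₁⟩ :=
    exists_equivalent_integral_lt R hint hSa1.neg ha.neg hRa
  have hPR := hPP'.trans hP'R
  refine ⟨Q₁, Q₂, ⟨hQ₁, hPR.trans hRQ₁, ⟨P', hP', hQ₁R.trans hRP'⟩, hi₁⟩,
    ⟨hQ₂, hPR.trans hRQ₂, ⟨P', hP', hQ₂R.trans hRP'⟩, hi₂⟩,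
    hQ₁R.trans hRQ₂, hQ₂R.trans hRQ₁, hlt₂, ?_⟩
  simp only [Pi.neg_apply, integral_neg] at hlt₁
  linarith
end
end

section
/- Define processes X, Y by the backward recursion X_T := S̲_T, Y_T := S̄_T and, for t = T−1,…,0 and ω ∈ Ω_t, X_t(ω) := (inf supp_{𝒫_t(ω)} X_{t+1}(ω,·)) ∨ S̲_t(ω) and Y_t(ω) := (sup supp_{𝒫_t(ω)} Y_{t+1}(ω,·)) ∧ S̄_t(ω). If S̲_t is lower semi-analytic and S̄_t is upper semi-analytic for all t, then for each t, X_t is lower semi-analytic and Y_t is upper semi-analytic. -/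
open MeasureTheory Set
open scoped ENNReal

noncomputable section

/-- A function is lower semi-analytic if its strict sublevel sets are analytic. -/
def LowerSemianalytic {α : Type*} [TopologicalSpace α] (f : α → ℝ) : Prop :=
  ∀ a : ℝ, AnalyticSet {x | f x < a}

/-- A function is upper semi-analytic if its strict superlevel sets are analytic. -/
def UpperSemianalytic {α : Type*} [TopologicalSpace α] (f : α → ℝ) : Prop :=
  ∀ a : ℝ, AnalyticSet {x | a < f x}

/-- Convexity for a set of probability measures. -/
def ConvexProb {α : Type*} [MeasurableSpace α] (𝒬 : Set (ProbabilityMeasure α)) : Prop :=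
  ∀ P ∈ 𝒬, ∀ Q ∈ 𝒬, ∀ a b : ℝ≥0∞, a + b = 1 → ∀ R : ProbabilityMeasure α,
    (R : Measure α) = a • (P : Measure α) + b • (Q : Measure α) → R ∈ 𝒬

/-- The support of the distribution of `f` under a family of probability measures: the smallest
closed set of full measure under every member of the family. -/
def rvSupportP {α : Type*} [MeasurableSpace α] (𝒬 : Set (ProbabilityMeasure α)) (f : α → ℝ) :
    Set ℝ :=
  ⋂₀ {F : Set ℝ | IsClosed F ∧ ∀ P ∈ 𝒬, (P : Measure α) (f ⁻¹' F) = 1}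

open Filter Topology

/-- In the Baire space, an ultrafilter that is eventually coordinatewise bounded converges. -/
theorem Ultrafilter.exists_tendsto_of_forall_eventually_le {ι : Type*} (u : Ultrafilter ι)
    (x : ι → ℕ → ℕ) (b : ℕ → ℕ) (h : ∀ i, ∀ᶠ n in (u : Filter ι), x n i ≤ b i) :
    ∃ c ≤ b, Tendsto x (u : Filter ι) (𝓝 c) := by
  have key : ∀ i, ∃ k ∈ Set.Iic (b i), ∀ᶠ n in (u : Filter ι), x n i = k := by
    intro i
    rw [← Ultrafilter.eventually_exists_mem_iff (Set.finite_Iic (b i))]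
    filter_upwards [h i] with n hn
    exact ⟨x n i, hn, rfl⟩
  choose c hcb hc using key
  refine ⟨c, hcb, tendsto_pi_nhds.2 fun i => ?_⟩
  rw [nhds_discrete, tendsto_pure]
  exact hc i

/-- Choquet's capacitability argument: the outer measure of a continuous image of a closed subset
of the Baire space is approximated by the images of its coordinatewise bounded parts. -/
theorem exists_le_measure_image_inter_Iic {α : Type*} [TopologicalSpace α] [MeasurableSpace α]
    (μ : Measure α) [μ.OuterRegular] {g : (ℕ → ℕ) → α} (hg : Continuous g)
    {L : Set (ℕ → ℕ)} (hL : IsClosed L) {r : ℝ≥0∞} (hr : r < μ (g '' L)) :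
    ∃ b : ℕ → ℕ, r ≤ μ (g '' (L ∩ Set.Iic b)) := by
  have hstep : ∀ (n : ℕ) (S : {S : Set (ℕ → ℕ) // r < μ (g '' S)}),
      ∃ m : ℕ, r < μ (g '' (S.1 ∩ {x | x n ≤ m})) := by
    rintro n ⟨S, hS⟩
    have hU : g '' S = ⋃ m : ℕ, g '' (S ∩ {x | x n ≤ m}) := by
      rw [← image_iUnion, ← inter_iUnion]
      congr 1
      refine (inter_eq_left.2 fun x _ => mem_iUnion.2 ⟨x n, ?_⟩).symm
      exact le_refl (x n)
    have hmono : Monotone fun m : ℕ => g '' (S ∩ {x | x n ≤ m}) := by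
      rintro a c hac _ ⟨x, ⟨hxS, hx⟩, rfl⟩
      exact ⟨x, ⟨hxS, le_trans hx hac⟩, rfl⟩
    rw [hU, hmono.measure_iUnion] at hS
    exact lt_iSup_iff.1 hS
  choose m hm using hstep
  let S : ℕ → {S : Set (ℕ → ℕ) // r < μ (g '' S)} := fun n =>
    Nat.rec ⟨L, hr⟩ (fun n S => ⟨S.1 ∩ {x | x n ≤ m n S}, hm n S⟩) n
  have hS : ∀ n, ∀ x ∈ (S n).1, x ∈ L ∧ ∀ i < n, x i ≤ m i (S i) := by
    intro n
    induction n with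
    | zero => exact fun x hx => ⟨hx, fun i hi => absurd hi (Nat.not_lt_zero i)⟩
    | succ n ih =>
      rintro x ⟨hx, hxn⟩
      refine ⟨(ih x hx).1, fun i hi => ?_⟩
      rcases Nat.lt_succ_iff_lt_or_eq.1 hi with hi | rfl
      · exact (ih x hx).2 i hi
      · exact hxn
  refine ⟨fun i => m i (S i), ?_⟩
  by_contra! hlt
  obtain ⟨U, hUsub, hU, hUr⟩ := Set.exists_isOpen_lt_of_lt _ r hlt
  have hex : ∀ n, ∃ x ∈ (S n).1, g x ∉ U := by
    intro n
    by_contra! hcon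
    exact lt_irrefl r ((S n).2.trans_le ((measure_mono (image_subset_iff.2 hcon)).trans hUr.le))
  choose x hxS hxU using hex
  obtain ⟨c, hcb, hc⟩ := (hyperfilter ℕ).exists_tendsto_of_forall_eventually_le x
    (fun i => m i (S i)) fun i => by
      have : ∀ᶠ n in (atTop : Filter ℕ), x n i ≤ m i (S i) := by
        filter_upwards [eventually_gt_atTop i] with n hn using (hS n _ (hxS n)).2 i hn
      exact this.filter_mono Nat.hyperfilter_le_atTop
  have hcL : c ∈ L := hL.mem_of_tendsto hc (Eventually.of_forall fun n => (hS n _ (hxS n)).1)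
  have hcU : g c ∈ Uᶜ := hU.isClosed_compl.mem_of_tendsto ((hg.tendsto c).comp hc)
    (Eventually.of_forall hxU)
  exact hcU (hUsub ⟨c, ⟨hcL, hcb⟩, rfl⟩)

theorem isCompact_Iic_baire (b : ℕ → ℕ) : IsCompact (Set.Iic b) := by
  have : Set.Iic b = Set.Icc 0 b := by
    ext x
    simp only [Set.mem_Iic, Set.mem_Icc, zero_le, true_and]
  rw [this]
  exact isCompact_Icc

/-- Analytic sets are universally measurable. -/
theorem MeasureTheory.AnalyticSet.nullMeasurableSet {α : Type*} [TopologicalSpace α]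
    [PolishSpace α] [MeasurableSpace α] [BorelSpace α] {s : Set α} (hs : AnalyticSet s)
    (μ : Measure α) [IsFiniteMeasure μ] : NullMeasurableSet s μ := by
  rw [AnalyticSet] at hs
  rcases hs with rfl | ⟨g, hg, rfl⟩
  · exact MeasurableSet.empty.nullMeasurableSet
  rcases eq_or_ne (μ (range g)) 0 with h0 | h0
  · exact NullMeasurableSet.of_null h0
  obtain ⟨v, -, hv, hvlim⟩ := exists_seq_strictMono_tendsto' (pos_iff_ne_zero.2 h0)
  have hb : ∀ n, ∃ b : ℕ → ℕ, v n ≤ μ (g '' Set.Iic b) := by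
    intro n
    have := exists_le_measure_image_inter_Iic μ hg isClosed_univ
      (r := v n) (by rw [image_univ]; exact (hv n).2)
    simpa only [univ_inter] using this
  choose b hb using hb
  have hmeas : MeasurableSet (⋃ n, g '' Set.Iic (b n)) :=
    MeasurableSet.iUnion fun n => ((isCompact_Iic_baire (b n)).image hg).measurableSet
  have hsub : (⋃ n, g '' Set.Iic (b n)) ⊆ range g := iUnion_subset fun n => image_subset_range _ _
  refine hmeas.nullMeasurableSet.congr
    (ae_eq_of_subset_of_measure_ge hsub ?_ hmeas.nullMeasurableSet (measure_ne_top _ _))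
  exact le_of_tendsto' hvlim fun n =>
    (hb n).trans (measure_mono (subset_iUnion (fun n => g '' Set.Iic (b n)) n))

/-- The measure of the sections of a coordinatewise bounded part of an analytic set is jointly
upper semicontinuous in the base point, the measure and the bound. -/
theorem isClosed_le_measure_section {Z α : Type*} [TopologicalSpace Z] [T2Space Z]
    [TopologicalSpace α] [PolishSpace α] [MeasurableSpace α] [BorelSpace α]
    {g : (ℕ → ℕ) → Z × α} (hg : Continuous g) (r : ℝ≥0∞) :
    IsClosed {p : (Z × ProbabilityMeasure α) × (ℕ → ℕ) |
      r ≤ (p.1.2 : Measure α) (Prod.mk p.1.1 ⁻¹' (g '' Set.Iic p.2))} := by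
  rw [← isOpen_compl_iff, isOpen_iff_mem_nhds]
  rintro ⟨⟨z, P⟩, b⟩ hp
  have hp : (P : Measure α) (Prod.mk z ⁻¹' (g '' Set.Iic b)) < r := not_le.1 hp
  have hclosed : IsClosed (Prod.mk z ⁻¹' (g '' Set.Iic b)) :=
    ((isCompact_Iic_baire b).image hg).isClosed.preimage (Continuous.prodMk_right z)
  obtain ⟨U, hCU, hU, hUr⟩ := Set.exists_isOpen_lt_of_lt _ r hp
  obtain ⟨V, hV, hCV, hVU⟩ := normal_exists_closure_subset hclosed hU hCU
  have hP : ∀ᶠ p : (Z × ProbabilityMeasure α) × (ℕ → ℕ) in 𝓝 ((z, P), b),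
      (p.1.2 : Measure α) (closure V) < r := by
    have hlim : Tendsto (fun p : (Z × ProbabilityMeasure α) × (ℕ → ℕ) => p.1.2)
        (𝓝 ((z, P), b)) (𝓝 P) :=
      (continuous_snd.comp continuous_fst).tendsto ((z, P), b)
    exact eventually_lt_of_limsup_lt
      ((ProbabilityMeasure.limsup_measure_closed_le_of_tendsto hlim isClosed_closure).trans_lt
        ((measure_mono hVU).trans_lt hUr))
  have hsub : ∀ᶠ p : (Z × ProbabilityMeasure α) × (ℕ → ℕ) in 𝓝 ((z, P), b),
      Prod.mk p.1.1 ⁻¹' (g '' Set.Iic p.2) ⊆ V := by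
    by_contra hcon
    rw [not_eventually, frequently_iff_neBot] at hcon
    obtain ⟨u, hu⟩ := Ultrafilter.exists_le (f := 𝓝 ((z, P), b) ⊓ 𝓟 {p |
      ¬ Prod.mk p.1.1 ⁻¹' (g '' Set.Iic p.2) ⊆ V})
    have hu₁ := hu.trans inf_le_left
    have hu₂ := le_principal_iff.1 (hu.trans inf_le_right)
    have hex : ∀ p : (Z × ProbabilityMeasure α) × (ℕ → ℕ), ∃ x : ℕ → ℕ,
        ¬ Prod.mk p.1.1 ⁻¹' (g '' Set.Iic p.2) ⊆ V →
          x ≤ p.2 ∧ (g x).1 = p.1.1 ∧ (g x).2 ∈ Vᶜ := by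
      intro p
      by_cases hpV : Prod.mk p.1.1 ⁻¹' (g '' Set.Iic p.2) ⊆ V
      · exact ⟨0, fun h => absurd hpV h⟩
      · obtain ⟨y, ⟨x, hx, hxy⟩, hyV⟩ := not_subset.1 hpV
        exact ⟨x, fun _ => ⟨hx, by rw [hxy], by rw [hxy]; exact hyV⟩⟩
    choose x hx using hex
    have hev : ∀ᶠ p in (u : Filter ((Z × ProbabilityMeasure α) × (ℕ → ℕ))),
        x p ≤ p.2 ∧ (g (x p)).1 = p.1.1 ∧ (g (x p)).2 ∈ Vᶜ := by
      filter_upwards [hu₂] with p hp using hx p hp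
    have hlimb : Tendsto (fun p : (Z × ProbabilityMeasure α) × (ℕ → ℕ) => p.2)
        (u : Filter _) (𝓝 b) := (continuous_snd.tendsto ((z, P), b)).mono_left hu₁
    have hlimz : Tendsto (fun p : (Z × ProbabilityMeasure α) × (ℕ → ℕ) => p.1.1)
        (u : Filter _) (𝓝 z) :=
      ((continuous_fst.comp continuous_fst).tendsto ((z, P), b)).mono_left hu₁
    obtain ⟨c, hcb, hc⟩ := u.exists_tendsto_of_forall_eventually_le x b fun i => by
      have hi := tendsto_pi_nhds.1 hlimb i
      rw [nhds_discrete, tendsto_pure] at hi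
      filter_upwards [hev, hi] with p hp hpi
      exact hpi ▸ hp.1 i
    have hgc := (hg.tendsto c).comp hc
    have hz : (g c).1 = z := by
      refine tendsto_nhds_unique ((continuous_fst.tendsto _).comp hgc) (hlimz.congr' ?_)
      filter_upwards [hev] with p hp using hp.2.1.symm
    have hcV : (g c).2 ∈ Vᶜ := by
      refine hV.isClosed_compl.mem_of_tendsto ((continuous_snd.tendsto _).comp hgc) ?_
      filter_upwards [hev] with p hp using hp.2.2
    exact hcV (hCV ⟨c, hcb, Prod.ext hz rfl⟩)
  filter_upwards [hP, hsub] with p hpP hpV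
  exact not_le.2 ((measure_mono (hpV.trans subset_closure)).trans_lt hpP)

/-- For an analytic family of probability measures, the set of points at which the section of an
analytic set is charged by some member of the family is analytic. -/
theorem MeasureTheory.AnalyticSet.exists_measure_section_ne_zero {Z α : Type*}
    [TopologicalSpace Z] [T2Space Z]
    [TopologicalSpace α] [PolishSpace α] [MeasurableSpace α] [BorelSpace α]
    {G : Set (Z × ProbabilityMeasure α)} (hG : AnalyticSet G) {A : Set (Z × α)}
    (hA : AnalyticSet A) :
    AnalyticSet {z | ∃ P, (z, P) ∈ G ∧ (P : Measure α) (Prod.mk z ⁻¹' A) ≠ 0} := by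
  rw [AnalyticSet] at hA
  rcases hA with rfl | ⟨g, hg, rfl⟩
  · convert! analyticSet_empty (α := Z)
    ext z
    simp
  rw [AnalyticSet] at hG
  rcases hG with rfl | ⟨h, hh, rfl⟩
  · convert! analyticSet_empty (α := Z)
    ext z
    simp
  let E : ℕ → Set ((ℕ → ℕ) × (ℕ → ℕ)) := fun n => {q | ((n : ℝ≥0∞) + 1)⁻¹ ≤
    ((h q.1).2 : Measure α) (Prod.mk (h q.1).1 ⁻¹' (g '' Set.Iic q.2))}
  have hE : ∀ n, IsClosed (E n) := fun n =>
    (isClosed_le_measure_section hg ((n : ℝ≥0∞) + 1)⁻¹).preimage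
      ((hh.comp continuous_fst).prodMk continuous_snd)
  have hEq : {z | ∃ P, (z, P) ∈ range h ∧ (P : Measure α) (Prod.mk z ⁻¹' range g) ≠ 0} =
      ⋃ n, (fun q : (ℕ → ℕ) × (ℕ → ℕ) => (h q.1).1) '' E n := by
    ext z
    constructor
    · rintro ⟨P, ⟨y, hy⟩, hP⟩
      obtain ⟨n, hn⟩ := ENNReal.exists_inv_nat_lt hP
      have hsec : (fun x => (g x).2) '' {x | (g x).1 = z} = Prod.mk z ⁻¹' range g := by
        ext a
        constructor
        · rintro ⟨x, hx, rfl⟩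
          exact ⟨x, Prod.ext hx rfl⟩
        · rintro ⟨x, hx⟩
          exact ⟨x, congrArg Prod.fst hx, congrArg Prod.snd hx⟩
      have hlt : ((n : ℝ≥0∞) + 1)⁻¹ < (P : Measure α) (Prod.mk z ⁻¹' range g) :=
        lt_of_le_of_lt (ENNReal.inv_le_inv.2 le_self_add) hn
      rw [← hsec] at hlt
      obtain ⟨b, hb⟩ := exists_le_measure_image_inter_Iic (P : Measure α)
        (continuous_snd.comp hg) (isClosed_eq (continuous_fst.comp hg) continuous_const) hlt
      refine mem_iUnion.2 ⟨n, (y, b), ?_, by simp [hy]⟩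
      change ((n : ℝ≥0∞) + 1)⁻¹ ≤ ((h y).2 : Measure α) (Prod.mk (h y).1 ⁻¹' (g '' Set.Iic b))
      rw [hy]
      refine hb.trans (measure_mono ?_)
      rintro _ ⟨x, ⟨hxz, hxb⟩, rfl⟩
      exact ⟨x, hxb, Prod.ext hxz rfl⟩
    · intro hz
      obtain ⟨n, ⟨y, b⟩, hq, rfl⟩ := mem_iUnion.1 hz
      refine ⟨(h y).2, ⟨y, rfl⟩, fun h0 => ?_⟩
      have hle : ((n : ℝ≥0∞) + 1)⁻¹ ≤ 0 :=
        (show ((n : ℝ≥0∞) + 1)⁻¹ ≤ _ from hq).trans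
          ((measure_mono (preimage_mono (image_subset_range _ _))).trans h0.le)
      exact absurd (le_zero_iff.1 hle) (ENNReal.inv_ne_zero.2 (by finiteness))
  rw [hEq]
  exact AnalyticSet.iUnion fun n => (hE n).analyticSet.image_of_continuous
    (continuous_fst.comp (hh.comp continuous_fst))

/-- An open set meets the support of `f` under a family of probability measures if and only if it
is charged by the distribution of `f` under some member of the family. -/
theorem rvSupportP_inter_nonempty_iff {α : Type*} [MeasurableSpace α]
    {𝒬 : Set (ProbabilityMeasure α)} {f : α → ℝ}
    (hf : ∀ P ∈ 𝒬, NullMeasurable f (P : Measure α)) {U : Set ℝ} (hU : IsOpen U) :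
    (rvSupportP 𝒬 f ∩ U).Nonempty ↔ ∃ P ∈ 𝒬, (P : Measure α) (f ⁻¹' U) ≠ 0 := by
  have hnull : ∀ P ∈ 𝒬, ∀ F : Set ℝ, IsClosed F →
      ((P : Measure α) (f ⁻¹' F) = 1 ↔ (P : Measure α) (f ⁻¹' Fᶜ) = 0) := by
    intro P hP F hF
    rw [preimage_compl, prob_compl_eq_zero_iff₀ (hf P hP hF.measurableSet)]
  constructor
  · rintro ⟨x, hx, hxU⟩
    by_contra! hcon
    refine hx Uᶜ ⟨hU.isClosed_compl, fun P hP => ?_⟩ hxU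
    rw [hnull P hP _ hU.isClosed_compl, compl_compl]
    exact hcon P hP
  · rintro ⟨P, hP, hPU⟩
    by_contra hcon
    rw [not_nonempty_iff_eq_empty] at hcon
    obtain ⟨c, hc, hcsub, hceq⟩ := TopologicalSpace.isOpen_sUnion_countable
      (compl '' {F : Set ℝ | IsClosed F ∧ ∀ P ∈ 𝒬, (P : Measure α) (f ⁻¹' F) = 1}) (by
        rintro _ ⟨F, hF, rfl⟩
        exact hF.1.isOpen_compl)
    refine hPU (measure_mono_null (t := ⋃ V ∈ c, f ⁻¹' V) ?_ ?_)
    · intro y hy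
      have hy' : f y ∉ rvSupportP 𝒬 f := fun h => by
        have : f y ∈ rvSupportP 𝒬 f ∩ U := ⟨h, hy⟩
        rw [hcon] at this
        exact this
      have : f y ∈ ⋃₀ c := by
        rw [hceq, ← compl_sInter]
        exact hy'
      obtain ⟨V, hV, hyV⟩ := this
      exact mem_biUnion hV hyV
    · refine (measure_biUnion_null_iff hc).2 fun V hV => ?_
      obtain ⟨F, hF, rfl⟩ := hcsub hV
      exact (hnull P hP F hF.1).1 (hF.2 P hP)

theorem LowerSemianalytic.comp {α β : Type*} [TopologicalSpace α] [PolishSpace α]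
    [TopologicalSpace β] [PolishSpace β] {f : β → ℝ} (hf : LowerSemianalytic f) {g : α → β}
    (hg : Continuous g) : LowerSemianalytic fun x => f (g x) :=
  fun a => (hf a).preimage hg

theorem UpperSemianalytic.comp {α β : Type*} [TopologicalSpace α] [PolishSpace α]
    [TopologicalSpace β] [PolishSpace β] {f : β → ℝ} (hf : UpperSemianalytic f) {g : α → β}
    (hg : Continuous g) : UpperSemianalytic fun x => f (g x) :=
  fun a => (hf a).preimage hg

theorem LowerSemianalytic.nullMeasurable {α : Type*} [TopologicalSpace α] [PolishSpace α]
    [MeasurableSpace α] [BorelSpace α] {f : α → ℝ} (hf : LowerSemianalytic f) (μ : Measure α)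
    [IsFiniteMeasure μ] : NullMeasurable f μ :=
  measurable_of_Iio (δ := NullMeasurableSpace α μ) fun a => (hf a).nullMeasurableSet μ

theorem UpperSemianalytic.nullMeasurable {α : Type*} [TopologicalSpace α] [PolishSpace α]
    [MeasurableSpace α] [BorelSpace α] {f : α → ℝ} (hf : UpperSemianalytic f) (μ : Measure α)
    [IsFiniteMeasure μ] : NullMeasurable f μ :=
  measurable_of_Ioi (δ := NullMeasurableSpace α μ) fun a => (hf a).nullMeasurableSet μ

theorem MeasureTheory.AnalyticSet.inter {α : Type*} [TopologicalSpace α] [T2Space α]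
    {s t : Set α} (hs : AnalyticSet s) (ht : AnalyticSet t) : AnalyticSet (s ∩ t) := by
  rw [inter_eq_iInter]
  exact AnalyticSet.iInter (Bool.forall_bool.2 ⟨ht, hs⟩)

theorem sInf_toEReal_image_lt_iff (s : Set ℝ) (a : ℝ) :
    sInf (Real.toEReal '' s) < (a : EReal) ↔ (s ∩ Set.Iio a).Nonempty := by
  simp only [sInf_lt_iff, exists_mem_image, EReal.coe_lt_coe_iff]
  rfl

theorem lt_sSup_toEReal_image_iff (s : Set ℝ) (a : ℝ) :
    (a : EReal) < sSup (Real.toEReal '' s) ↔ (s ∩ Set.Ioi a).Nonempty := by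
  simp only [lt_sSup_iff, exists_mem_image, EReal.coe_lt_coe_iff]
  rfl

/-- One step of the lower recursion preserves lower semi-analyticity. -/
theorem LowerSemianalytic.of_eq_max_sInf_rvSupportP {Z α : Type*} [TopologicalSpace Z]
    [PolishSpace Z] [TopologicalSpace α] [PolishSpace α] [MeasurableSpace α] [BorelSpace α]
    {𝒬 : Z → Set (ProbabilityMeasure α)}
    (h𝒬 : AnalyticSet {p : Z × ProbabilityMeasure α | p.2 ∈ 𝒬 p.1})
    {f : Z × α → ℝ} (hf : LowerSemianalytic f) {S X : Z → ℝ} (hS : LowerSemianalytic S)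
    (hX : ∀ z, (X z : EReal) =
      max (sInf (Real.toEReal '' rvSupportP (𝒬 z) fun y => f (z, y))) (S z : EReal)) :
    LowerSemianalytic X := by
  intro a
  convert! (h𝒬.exists_measure_section_ne_zero (hf a)).inter (hS a) using 1
  ext z
  have hnull : ∀ P ∈ 𝒬 z, NullMeasurable (fun y => f (z, y)) (P : Measure α) := fun P _ =>
    (hf.comp (Continuous.prodMk_right z)).nullMeasurable _
  change X z < a ↔ (∃ P ∈ 𝒬 z, (P : Measure α) ((fun y => f (z, y)) ⁻¹' Set.Iio a) ≠ 0) ∧ S z < a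
  rw [← rvSupportP_inter_nonempty_iff hnull isOpen_Iio, ← sInf_toEReal_image_lt_iff,
    ← EReal.coe_lt_coe_iff, hX z, max_lt_iff, EReal.coe_lt_coe_iff]

/-- One step of the upper recursion preserves upper semi-analyticity. -/
theorem UpperSemianalytic.of_eq_min_sSup_rvSupportP {Z α : Type*} [TopologicalSpace Z]
    [PolishSpace Z] [TopologicalSpace α] [PolishSpace α] [MeasurableSpace α] [BorelSpace α]
    {𝒬 : Z → Set (ProbabilityMeasure α)}
    (h𝒬 : AnalyticSet {p : Z × ProbabilityMeasure α | p.2 ∈ 𝒬 p.1})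
    {f : Z × α → ℝ} (hf : UpperSemianalytic f) {S Y : Z → ℝ} (hS : UpperSemianalytic S)
    (hY : ∀ z, (Y z : EReal) =
      min (sSup (Real.toEReal '' rvSupportP (𝒬 z) fun y => f (z, y))) (S z : EReal)) :
    UpperSemianalytic Y := by
  intro a
  convert! (h𝒬.exists_measure_section_ne_zero (hf a)).inter (hS a) using 1
  ext z
  have hnull : ∀ P ∈ 𝒬 z, NullMeasurable (fun y => f (z, y)) (P : Measure α) := fun P _ =>
    (hf.comp (Continuous.prodMk_right z)).nullMeasurable _
  change a < Y z ↔ (∃ P ∈ 𝒬 z, (P : Measure α) ((fun y => f (z, y)) ⁻¹' Set.Ioi a) ≠ 0) ∧ a < S z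
  rw [← rvSupportP_inter_nonempty_iff hnull isOpen_Ioi, ← lt_sSup_toEReal_image_iff,
    ← EReal.coe_lt_coe_iff, hY z, lt_min_iff, EReal.coe_lt_coe_iff]

/-- Lemma 4.1. If `X, Y` are defined by the backward recursion
`X_T = S̲_T`, `Y_T = S̄_T`, `X_t = (inf supp_{𝒫_t} X_{t+1}) ∨ S̲_t`,
`Y_t = (sup supp_{𝒫_t} Y_{t+1}) ∧ S̄_t` (the `inf`/`sup` being computed in `EReal`), then each
`X_t` is lower semi-analytic and each `Y_t` is upper semi-analytic. -/
theorem backward_recursion_semianalytic {Ω₁ : Type*} [TopologicalSpace Ω₁] [PolishSpace Ω₁]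
    [MeasurableSpace Ω₁] [BorelSpace Ω₁] (T : ℕ)
    (𝒬 : (t : ℕ) → (Fin t → Ω₁) → Set (ProbabilityMeasure Ω₁))
    (h𝒬ne : ∀ t, t < T → ∀ ω, (𝒬 t ω).Nonempty)
    (h𝒬conv : ∀ t, t < T → ∀ ω, ConvexProb (𝒬 t ω))
    (h𝒬graph : ∀ t, t < T →
      AnalyticSet {p : (Fin t → Ω₁) × ProbabilityMeasure Ω₁ | p.2 ∈ 𝒬 t p.1})
    (Sb Sa : (t : ℕ) → (Fin t → Ω₁) → ℝ)
    (hSb : ∀ t, t ≤ T → LowerSemianalytic (Sb t))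
    (hSa : ∀ t, t ≤ T → UpperSemianalytic (Sa t))
    (X Y : (t : ℕ) → (Fin t → Ω₁) → ℝ)
    (hXT : X T = Sb T) (hYT : Y T = Sa T)
    (hX : ∀ t, t < T → ∀ ω, (X t ω : EReal) =
      max (sInf (Real.toEReal ''
          rvSupportP (𝒬 t ω) (fun ω' => X (t + 1) (Fin.snoc ω ω')))) (Sb t ω : EReal))
    (hY : ∀ t, t < T → ∀ ω, (Y t ω : EReal) =
      min (sSup (Real.toEReal ''
          rvSupportP (𝒬 t ω) (fun ω' => Y (t + 1) (Fin.snoc ω ω')))) (Sa t ω : EReal)) :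
    ∀ t, t ≤ T → LowerSemianalytic (X t) ∧ UpperSemianalytic (Y t) := by
  intro t ht
  induction ht using Nat.decreasingInduction with
  | self => exact ⟨hXT ▸ hSb T le_rfl, hYT ▸ hSa T le_rfl⟩
  | of_succ t ht ih =>
    have hsnoc : Continuous fun p : (Fin t → Ω₁) × Ω₁ =>
        (Fin.snoc p.1 p.2 : Fin (t + 1) → Ω₁) :=
      Continuous.finSnoc (A := fun _ => Ω₁) continuous_fst continuous_snd
    exact ⟨.of_eq_max_sInf_rvSupportP (h𝒬graph t ht) (ih.1.comp hsnoc) (hSb t ht.le) (hX t ht),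
      .of_eq_min_sSup_rvSupportP (h𝒬graph t ht) (ih.2.comp hsnoc) (hSa t ht.le) (hY t ht)⟩
end
end

section
/- Assume efficient friction holds. Then NA₂(𝒫) implies NA^s(𝒫); that is, if L⁰_𝒫(K_{t+1};𝓕_t) ⊆ L⁰_𝒫(K_t;𝓕_t) for all t, then A_t ∩ L⁰_𝒫(K_t;𝓕_t) ⊆ L⁰_𝒫(K⁰_t;𝓕_t) for all t ∈ {0,…,T}. -/
open MeasureTheory Set
open scoped ENNReal Pointwise

noncomputable section

/-- The universal completion of the σ-algebra on `α`. -/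
def univComp (α : Type*) [MeasurableSpace α] : MeasurableSpace α where
  MeasurableSet' s := ∀ μ : Measure α, IsProbabilityMeasure μ → NullMeasurableSet s μ
  measurableSet_empty := fun _ _ => MeasurableSet.empty.nullMeasurableSet
  measurableSet_compl := fun _ hs μ hμ => (hs μ hμ).compl
  measurableSet_iUnion := fun _ hf μ hμ => NullMeasurableSet.iUnion fun i => hf i μ hμ

/-- A universally measurable set. -/
def UnivMeasurableSet {α : Type*} [MeasurableSpace α] (s : Set α) : Prop :=
  MeasurableSet[univComp α] s

/-- A universally measurable function. -/
def UnivMeasurable {α β : Type*} [MeasurableSpace α] [MeasurableSpace β] (f : α → β) : Prop :=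
  Measurable[univComp α] f

/-- The product measure `P₀ ⊗ ⋯ ⊗ P_{T-1}` of a family of one-step kernels. -/
def prodMeas {Ω₁ : Type*} [MeasurableSpace Ω₁]
    (P : (t : ℕ) → (Fin t → Ω₁) → Measure Ω₁) : (T : ℕ) → Measure (Fin T → Ω₁)
  | 0 => Measure.dirac (fun i => i.elim0)
  | T + 1 => (prodMeas P T).bind fun ω => (P T ω).map (Fin.snoc ω)

/-- The set `𝒫` of all products of universally measurable selectors of the `𝒫ₜ`. -/
def ProdSet {Ω₁ : Type*} [MeasurableSpace Ω₁]
    (𝒬 : (t : ℕ) → (Fin t → Ω₁) → Set (ProbabilityMeasure Ω₁)) (T : ℕ) :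
    Set (Measure (Fin T → Ω₁)) :=
  {μ | ∃ P : (t : ℕ) → (Fin t → Ω₁) → ProbabilityMeasure Ω₁,
      (∀ t, t < T → UnivMeasurable (fun ω => (P t ω : Measure Ω₁)) ∧ ∀ ω, P t ω ∈ 𝒬 t ω) ∧
      μ = prodMeas (fun t ω => (P t ω : Measure Ω₁)) T}

/-- Projection onto the first `t` coordinates. -/
def proj {Ω₁ : Type*} (T t : ℕ) (ht : t ≤ T) (ω : Fin T → Ω₁) : Fin t → Ω₁ :=
  fun i => ω (Fin.castLE ht i)

/-- The σ-algebra `𝓕ₜ` on `Ω = Ω₁^T`: the pullback under the projection onto the first `t`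
coordinates of the universal completion of the Borel σ-algebra of `Ω₁^t`. -/
def filt {Ω₁ : Type*} [MeasurableSpace Ω₁] (T t : ℕ) (ht : t ≤ T) :
    MeasurableSpace (Fin T → Ω₁) :=
  MeasurableSpace.comap (proj T t ht) (univComp (Fin t → Ω₁))

/-- The dual cone of a set in `ℝ^d`. -/
def dualCone {d : ℕ} (C : Set (Fin d → ℝ)) : Set (Fin d → ℝ) :=
  {y | ∀ x ∈ C, 0 ≤ ∑ i, x i * y i}

/-- `f ∈ Aₜ`: attainable claims at time `t` from zero endowment, i.e. `f = ξ₀ + ⋯ + ξₜ`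
with each `ξₛ` an `𝓕ₛ`-measurable function with values in `−Cₛ`. -/
def Attainable {Ω₁ : Type*} [MeasurableSpace Ω₁] {d : ℕ}
    (C : (s : ℕ) → (Fin s → Ω₁) → Set (Fin d → ℝ)) (t : ℕ)
    (f : (Fin t → Ω₁) → Fin d → ℝ) : Prop :=
  ∃ ξ : ℕ → (Fin t → Ω₁) → Fin d → ℝ,
    (∀ s, ∀ hs : s ≤ t, ∃ g : (Fin s → Ω₁) → Fin d → ℝ, UnivMeasurable g ∧
      (∀ ωs, g ωs ∈ -C s ωs) ∧ ∀ ω, ξ s ω = g fun i => ω (Fin.castLE hs i)) ∧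
    ∀ ω, f ω = ∑ s ∈ Finset.range (t + 1), ξ s ω

/-- Strict no-arbitrage `NAˢ(𝒫)` for the market with solvency cones `C`:
`Aₜ ∩ L⁰_𝒫(Cₜ; 𝓕ₜ) ⊆ L⁰_𝒫(C⁰ₜ; 𝓕ₜ)` for all `t ∈ {0, …, T}`. -/
def StrictNoArbitrage {Ω₁ : Type*} [MeasurableSpace Ω₁] {d : ℕ}
    (𝒬 : (t : ℕ) → (Fin t → Ω₁) → Set (ProbabilityMeasure Ω₁))
    (C : (s : ℕ) → (Fin s → Ω₁) → Set (Fin d → ℝ)) (T : ℕ) : Prop :=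
  ∀ t, t ≤ T → ∀ f : (Fin t → Ω₁) → Fin d → ℝ, Attainable C t f → UnivMeasurable f →
    (∀ μ ∈ ProdSet 𝒬 t, ∀ᵐ ω ∂μ, f ω ∈ C t ω) →
    (∀ μ ∈ ProdSet 𝒬 t, ∀ᵐ ω ∂μ, f ω ∈ C t ω ∩ -C t ω)

/-- Efficient friction: `int C*ₜ ≠ ∅` `𝒫`-q.s. for all `t`. -/
def EfficientFriction {Ω₁ : Type*} [MeasurableSpace Ω₁] {d : ℕ}
    (𝒬 : (t : ℕ) → (Fin t → Ω₁) → Set (ProbabilityMeasure Ω₁))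
    (C : (s : ℕ) → (Fin s → Ω₁) → Set (Fin d → ℝ)) (T : ℕ) : Prop :=
  ∀ t, t ≤ T → ∀ μ ∈ ProdSet 𝒬 t, ∀ᵐ ω ∂μ, (interior (dualCone (C t ω))).Nonempty

/-- `NA₂(𝒫)`: `L⁰_𝒫(Cₜ₊₁; 𝓕ₜ) ⊆ L⁰_𝒫(Cₜ; 𝓕ₜ)` for all `t`. -/
def NoArbitrage2 {Ω₁ : Type*} [MeasurableSpace Ω₁] {d : ℕ}
    (𝒬 : (t : ℕ) → (Fin t → Ω₁) → Set (ProbabilityMeasure Ω₁))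
    (C : (s : ℕ) → (Fin s → Ω₁) → Set (Fin d → ℝ)) (T : ℕ) : Prop :=
  ∀ t, t < T → ∀ f : (Fin t → Ω₁) → Fin d → ℝ, UnivMeasurable f →
    (∀ μ ∈ ProdSet 𝒬 (t + 1), ∀ᵐ ω ∂μ, f (Fin.init ω) ∈ C (t + 1) ω) →
    (∀ μ ∈ ProdSet 𝒬 t, ∀ᵐ ω ∂μ, f ω ∈ C t ω)

/-- Universal measurability is preserved by precomposition with a measurable map. -/
theorem UnivMeasurable.comp_measurable {α β γ : Type*} [MeasurableSpace α] [MeasurableSpace β]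
    [MeasurableSpace γ] {g : β → γ} {p : α → β} (hg : UnivMeasurable g) (hp : Measurable p) :
    UnivMeasurable fun a => g (p a) := by
  intro s hs μ hμ
  have hprob : IsProbabilityMeasure (μ.map p) := Measure.isProbabilityMeasure_map hp.aemeasurable
  exact (hg hs (μ.map p) hprob).preimage (hp.quasiMeasurePreserving μ)

/-- A finite sum of universally measurable vector-valued functions is universally measurable. -/
theorem UnivMeasurable.finset_sum {α ι : Type*} [MeasurableSpace α] {d : ℕ} (S : Finset ι)
    {f : ι → α → Fin d → ℝ} (hf : ∀ i ∈ S, UnivMeasurable (f i)) :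
    UnivMeasurable fun a => ∑ i ∈ S, f i a :=
  @Finset.measurable_fun_sum _ _ _ _ _ _ (univComp α) f S hf

/-- A property holding almost surely up to time `t` also holds almost surely
up to time `t + 1`. -/
theorem ae_init_of_ae_prodMeas {Ω₁ : Type*} [MeasurableSpace Ω₁]
    (P : (t : ℕ) → (Fin t → Ω₁) → Measure Ω₁) {t : ℕ} {p : (Fin t → Ω₁) → Prop}
    (h : ∀ᵐ ω ∂prodMeas P t, p ω) : ∀ᵐ ω ∂prodMeas P (t + 1), p (Fin.init ω) := by
  have hinit : Measurable (Fin.init : (Fin (t + 1) → Ω₁) → Fin t → Ω₁) :=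
    measurable_pi_lambda _ fun i => measurable_pi_apply i.castSucc
  set κ : (Fin t → Ω₁) → Measure (Fin (t + 1) → Ω₁) := fun ω => (P t ω).map (Fin.snoc ω)
  change ∀ᵐ ω ∂(prodMeas P t).bind κ, p (Fin.init ω)
  by_cases hκ : AEMeasurable κ (prodMeas P t)
  · obtain ⟨N, hpN, hN, hN0⟩ := exists_measurable_superset_of_null (ae_iff.1 h)
    refine measure_mono_null (t := Fin.init ⁻¹' N) (fun ω hω => hpN hω) ?_
    rw [Measure.bind_apply (hinit hN) hκ]
    refine lintegral_eq_zero_of_ae_eq_zero ?_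
    filter_upwards [measure_eq_zero_iff_ae_notMem.1 hN0] with ω hω
    have hsnoc : Measurable (Fin.snoc (α := fun _ => Ω₁) ω) := by
      refine measurable_pi_lambda _ fun i => ?_
      induction i using Fin.lastCases with
      | last => simpa only [Fin.snoc_last] using measurable_id'
      | cast i => simp
    change (P t ω).map (Fin.snoc (α := fun _ => Ω₁) ω) (Fin.init ⁻¹' N) = 0
    rw [Measure.map_apply hsnoc (hinit hN)]
    convert measure_empty (μ := P t ω)
    ext x
    simpa using hω
  · simp [Measure.bind, Measure.map_of_not_aemeasurable hκ]

/-- A set whose dual cone has nonempty interior contains no line through the origin. -/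
theorem eq_zero_of_mem_of_neg_mem_of_interior_dualCone {d : ℕ} {C : Set (Fin d → ℝ)}
    (hC : (interior (dualCone C)).Nonempty) {x : Fin d → ℝ} (hx : x ∈ C) (hx' : -x ∈ C) :
    x = 0 := by
  have hzero : ∀ y ∈ dualCone C, dotProduct x y = 0 := by
    intro y hy
    have h₁ : 0 ≤ dotProduct x y := hy x hx
    have h₂ : 0 ≤ dotProduct (-x) y := hy (-x) hx'
    rw [neg_dotProduct] at h₂
    linarith
  obtain ⟨y, hy⟩ := hC
  have hcont : Filter.Tendsto (fun ε : ℝ => y + ε • x) (nhdsWithin 0 (Ioi 0)) (nhds y) := by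
    have : Continuous fun ε : ℝ => y + ε • x := by fun_prop
    simpa using (this.tendsto 0).mono_left nhdsWithin_le_nhds
  obtain ⟨ε, hε, hpos⟩ :=
    ((hcont.eventually (mem_interior_iff_mem_nhds.1 hy)).and self_mem_nhdsWithin).exists
  have h := hzero _ hε
  rw [dotProduct_add, hzero y (interior_subset hy), zero_add, dotProduct_smul, smul_eq_mul] at h
  exact dotProduct_self_eq_zero.1 ((mul_eq_zero.1 h).resolve_left (ne_of_gt hpos))

/-- Lemma 5.3. Under efficient friction, `NA₂(𝒫)` implies `NAˢ(𝒫)`. -/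
theorem NA2_implies_NAs {Ω₁ : Type*} [TopologicalSpace Ω₁] [PolishSpace Ω₁]
    [MeasurableSpace Ω₁] [BorelSpace Ω₁] (T d : ℕ)
    (𝒬 : (t : ℕ) → (Fin t → Ω₁) → Set (ProbabilityMeasure Ω₁))
    (h𝒬ne : ∀ t, t < T → ∀ ω, (𝒬 t ω).Nonempty)
    (h𝒬conv : ∀ t, t < T → ∀ ω, ConvexProb (𝒬 t ω))
    (h𝒬graph : ∀ t, t < T →
      AnalyticSet {p : (Fin t → Ω₁) × ProbabilityMeasure Ω₁ | p.2 ∈ 𝒬 t p.1})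
    (K : (t : ℕ) → (Fin t → Ω₁) → Set (Fin d → ℝ))
    (hKcl : ∀ t, t ≤ T → ∀ ω, IsClosed (K t ω))
    (hKconv : ∀ t, t ≤ T → ∀ ω, Convex ℝ (K t ω))
    (hKcone : ∀ t, t ≤ T → ∀ ω, ∀ c : ℝ, 0 ≤ c → ∀ x ∈ K t ω, c • x ∈ K t ω)
    (hKorth : ∀ t, t ≤ T → ∀ ω, {x : Fin d → ℝ | ∀ i, 0 ≤ x i} ⊆ K t ω)
    (hKgraph : ∀ t, t ≤ T →
      AnalyticSet {p : (Fin t → Ω₁) × (Fin d → ℝ) | p.2 ∈ dualCone (K t p.1)})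
    (hEF : EfficientFriction 𝒬 K T)
    (hNA2 : NoArbitrage2 𝒬 K T) :
    StrictNoArbitrage 𝒬 K T := by
  have hadd : ∀ t, t ≤ T → ∀ ω, ∀ x ∈ K t ω, ∀ y ∈ K t ω, x + y ∈ K t ω := by
    intro t ht ω x hx y hy
    have h := hKcone t ht ω 2 (by norm_num) _
      (hKconv t ht ω hx hy (a := 1 / 2) (b := 1 / 2) (by norm_num) (by norm_num) (by norm_num))
    rwa [smul_add, smul_smul, smul_smul, show (2 : ℝ) * (1 / 2) = 1 by norm_num, one_smul,
      one_smul] at h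
  intro t
  induction t with
  | zero =>
    rintro ht f ⟨ξ, hξ, hf⟩ - hfK μ hμ
    obtain ⟨g, -, hgK, hg⟩ := hξ 0 le_rfl
    filter_upwards [hfK μ hμ] with ω hω
    refine ⟨hω, ?_⟩
    rw [hf ω, Finset.sum_range_one, hg ω]
    exact hgK ω
  | succ t ih =>
    rintro ht f ⟨ξ, hξ, hf⟩ - hfK μ hμ
    have htT : t ≤ T := by omega
    choose g hgm hgK hg using hξ
    set η : ℕ → (Fin t → Ω₁) → Fin d → ℝ := fun s ω =>
      if hs : s ≤ t then g s (by omega) fun i => ω (Fin.castLE hs i) else 0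
    set f' : (Fin t → Ω₁) → Fin d → ℝ := fun ω => ∑ s ∈ Finset.range (t + 1), η s ω
    have hη : ∀ s, ∀ hs : s ≤ t,
        η s = fun ω => g s (hs.trans t.le_succ) fun i => ω (Fin.castLE hs i) := by
      intro s hs
      funext ω
      exact dif_pos hs
    have hf' : UnivMeasurable f' := by
      refine UnivMeasurable.finset_sum _ fun s hs => ?_
      have hst : s ≤ t := by
        have := Finset.mem_range.1 hs
        omega
      rw [hη s hst]
      exact (hgm s _).comp_measurable (measurable_pi_lambda _ fun i => measurable_pi_apply _)
    have hatt : Attainable K t f' :=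
      ⟨η, fun s hs => ⟨g s _, hgm s _, hgK s _, congrFun (hη s hs)⟩, fun _ => rfl⟩
    have hsplit : ∀ ω, f ω = f' (Fin.init ω) + g (t + 1) le_rfl ω := by
      intro ω
      rw [hf ω, Finset.sum_range_succ, hg (t + 1) le_rfl ω]
      congr 1
      refine Finset.sum_congr rfl fun s hs => ?_
      have hst : s ≤ t := by
        have := Finset.mem_range.1 hs
        omega
      rw [hη s hst, hg s (hst.trans t.le_succ) ω]
      rfl
    have hf'K : ∀ ν ∈ ProdSet 𝒬 t, ∀ᵐ ω ∂ν, f' ω ∈ K t ω := by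
      refine hNA2 t ht f' hf' fun ν hν => ?_
      filter_upwards [hfK ν hν] with ω hω
      have h := hadd (t + 1) ht ω _ hω _ (hgK (t + 1) le_rfl ω)
      rwa [hsplit ω, add_neg_cancel_right] at h
    have hf'0 : ∀ ν ∈ ProdSet 𝒬 t, ∀ᵐ ω ∂ν, f' ω = 0 := by
      intro ν hν
      filter_upwards [ih htT f' hatt hf' hf'K ν hν, hEF t htT ν hν] with ω hω hint
      exact eq_zero_of_mem_of_neg_mem_of_interior_dualCone hint hω.1 hω.2
    obtain ⟨P, hP, rfl⟩ := id hμ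
    have hinit := ae_init_of_ae_prodMeas (fun s ω => (P s ω : Measure Ω₁))
      (hf'0 _ ⟨P, fun s hs => hP s (by omega), rfl⟩)
    filter_upwards [hfK _ hμ, hinit] with ω hω hω0
    refine ⟨hω, ?_⟩
    rw [hsplit ω, hω0, zero_add]
    exact hgK (t + 1) le_rfl ω
end
end
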